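/- For every u ∈ Λ₀ with ‖u‖_{L²} = 1, the energy E(u) = ½∫(ε²x₁² + κ²x₂²)|u|² + (g₀/2)∫|u|⁴ satisfies E(u) ≥ κ²/(8π). -/

import Mathlib

open MeasureTheory Real

theorem parseval_aux (g : ℝ → ℂ) (hg : Continuous g) :
    ∫⁻ θ in Set.Ioo (-π) π, ENNReal.ofReal (‖g θ‖^2) =
      ENNReal.ofReal (2*π) * ∑' n : ℤ, ENNReal.ofReal
        (‖((2*π : ℝ) : ℂ)⁻¹ * ∫ θ in (-π)..π, Complex.exp (-(n * θ * Complex.I)) * g θ‖^2) := by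
  have hab : -π < π := by linarith [pi_pos]
  have hL2 : MemLp g 2 (volume.restrict (Set.Ioc (-π) π)) :=
    (memLp_two_iff_integrable_sq_norm hg.aestronglyMeasurable).2
      (((hg.norm.pow 2).integrableOn_Icc).mono_set Set.Ioc_subset_Icc_self)
  have h := hasSum_sq_fourierCoeffOn hab hL2
  have hc : ∀ n : ℤ, fourierCoeffOn hab g n =
      ((2*π : ℝ) : ℂ)⁻¹ * ∫ θ in (-π)..π, Complex.exp (-(n * θ * Complex.I)) * g θ := by
    intro n
    rw [fourierCoeffOn_eq_integral]
    have : π - -π = 2 * π := by ring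
    rw [this, Complex.real_smul]
    congr 1
    · push_cast; simp
    · refine intervalIntegral.integral_congr fun θ _ => ?_
      simp only [smul_eq_mul]
      rw [fourier_coe_apply]
      congr 2
      have : (π : ℂ) ≠ 0 := by exact_mod_cast pi_ne_zero
      push_cast
      field_simp
  simp_rw [hc] at h
  have hi : Integrable (fun θ => ‖g θ‖^2) (volume.restrict (Set.Ioc (-π) π)) :=
    ((hg.norm.pow 2).integrableOn_Icc).mono_set Set.Ioc_subset_Icc_self
  rw [← ENNReal.ofReal_tsum_of_nonneg (fun _ => by positivity) h.summable, h.tsum_eq,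
    ← ENNReal.ofReal_mul (by positivity), restrict_Ioo_eq_restrict_Ioc,
    ← ofReal_integral_eq_lintegral_ofReal hi (ae_of_all _ fun _ => by positivity),
    intervalIntegral.integral_of_le hab.le]
  congr 1
  have := pi_pos
  rw [smul_eq_mul, show π - -π = 2 * π by ring]
  field_simp

/-- coefficient on circle -/
noncomputable def circC (a : ℕ → ℂ) (r : ℝ) (n : ℤ) : ℂ :=
  if 0 ≤ n then a n.toNat * (r:ℂ) ^ n.toNat else 0

theorem integral_exp_int (n : ℤ) :
    ∫ θ in (-π)..π, Complex.exp (n * θ * Complex.I) = if n = 0 then ((2*π : ℝ) : ℂ) else 0 := by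
  split_ifs with h
  · subst h
    simp; ring
  · have hn : (n * Complex.I : ℂ) ≠ 0 := by
      simp [h]
    have := integral_exp_mul_complex (a := -π) (b := π) hn
    rw [show (fun θ : ℝ => Complex.exp (n * θ * Complex.I)) =
      fun θ : ℝ => Complex.exp (n * Complex.I * θ) by funext; ring_nf, this]
    have e : (n * Complex.I * (π:ℝ) : ℂ) = n * Complex.I * ((-π : ℝ) : ℂ) + n * (2 * π * Complex.I) := by
      push_cast; ring
    rw [e, Complex.exp_add, Complex.exp_int_mul_two_pi_mul_I]
    simp

theorem coef_aux (f : ℂ → ℂ) (a : ℕ → ℂ) (hs : ∀ z, HasSum (fun k => a k * z^k) (f z))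
    (r : ℝ) (n : ℤ) :
    ((2*π : ℝ) : ℂ)⁻¹ * ∫ θ in (-π)..π, Complex.exp (-(n * θ * Complex.I)) *
      f (r * Complex.exp (θ * Complex.I)) = circC a r n := by
  have key := intervalIntegral.hasSum_integral_of_dominated_convergence (μ := volume) (a := -π) (b := π)
    (F := fun (k:ℕ) (θ : ℝ) => Complex.exp (-(n * θ * Complex.I)) * (a k * (r * Complex.exp (θ * Complex.I))^k))
    (f := fun θ : ℝ => Complex.exp (-(n * θ * Complex.I)) * f (r * Complex.exp (θ * Complex.I)))
    (fun k _ => ‖a k * (r:ℂ)^k‖)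
    (fun k => by
      apply Continuous.aestronglyMeasurable
      fun_prop)
    (fun k => ae_of_all _ fun θ _ => by
      have e : ‖Complex.exp (-(n * θ * Complex.I))‖ = 1 := by
        rw [Complex.norm_exp]; simp
      have e2 : ‖Complex.exp (θ * Complex.I)‖ = 1 := Complex.norm_exp_ofReal_mul_I θ
      simp [e, e2])
    (ae_of_all _ fun θ _ => (hs r).summable.norm)
    intervalIntegrable_const
    (ae_of_all _ fun θ _ => (hs _).mul_left _)
  have hk : ∀ k : ℕ, ∫ θ in (-π)..π, Complex.exp (-(n * θ * Complex.I)) * (a k * (r * Complex.exp (θ * Complex.I))^k)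
     = if (k:ℤ) = n then ((2*π : ℝ) : ℂ) * (a k * (r:ℂ)^k) else 0 := by
    intro k
    have : ∀ θ : ℝ, Complex.exp (-(n * θ * Complex.I)) * (a k * (r * Complex.exp (θ * Complex.I))^k)
      = (a k * (r:ℂ)^k) * Complex.exp (((k - n : ℤ):ℂ) * θ * Complex.I) := by
      intro θ
      rw [mul_pow, ← Complex.exp_nat_mul]
      have : Complex.exp (((k - n : ℤ):ℂ) * θ * Complex.I) = Complex.exp (-(n * θ * Complex.I)) * Complex.exp (k * (θ * Complex.I)) := by
        rw [← Complex.exp_add]; congr 1; push_cast; ring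
      rw [this]; ring
    simp_rw [this]
    rw [intervalIntegral.integral_const_mul, integral_exp_int]
    simp only [sub_eq_zero]
    split_ifs <;> ring
  simp_rw [hk] at key
  have h2 : HasSum (fun k : ℕ => if (k:ℤ) = n then ((2*π : ℝ) : ℂ) * (a k * (r:ℂ)^k) else 0)
      (((2*π : ℝ) : ℂ) * circC a r n) := by
    unfold circC
    split_ifs with h
    · lift n to ℕ using h
      have := hasSum_ite_eq n (((2*π : ℝ) : ℂ) * (a n * (r:ℂ)^n))
      simp only [Int.toNat_natCast, Nat.cast_inj]
      convert this using 2 with k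
      split_ifs with hkn
      · rw [hkn]
      · rfl
    · rw [mul_zero]
      convert hasSum_zero using 2 with k
      rw [if_neg]; omega
  rw [key.unique h2]
  have : ((2*π : ℝ) : ℂ) ≠ 0 := by exact_mod_cast (by positivity : (2*π:ℝ) ≠ 0)
  field_simp

theorem coef_aux2 (f : ℂ → ℂ) (a : ℕ → ℂ) (hs : ∀ z, HasSum (fun k => a k * z^k) (f z))
    (hf : Continuous f) (r : ℝ) (n : ℤ) :
    ((2*π : ℝ) : ℂ)⁻¹ * ∫ θ in (-π)..π, Complex.exp (-(n * θ * Complex.I)) *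
      (((r * Real.sin θ : ℝ) : ℂ) * f (r * Complex.exp (θ * Complex.I))) =
      r / (2 * Complex.I) * (circC a r (n-1) - circC a r (n+1)) := by
  rw [← coef_aux f a hs r (n-1), ← coef_aux f a hs r (n+1), ← mul_sub, 
    ← intervalIntegral.integral_sub, mul_left_comm (_ / _)]
  · congr 1
    rw [← intervalIntegral.integral_const_mul]
    apply intervalIntegral.integral_congr
    intro θ _
    simp only
    have e1 : Complex.exp (-(((n-1:ℤ):ℂ) * θ * Complex.I)) = Complex.exp (-(n * θ * Complex.I)) * Complex.exp (θ * Complex.I) := by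
      rw [← Complex.exp_add]; congr 1; push_cast; ring
    have e2 : Complex.exp (-(((n+1:ℤ):ℂ) * θ * Complex.I)) = Complex.exp (-(n * θ * Complex.I)) * Complex.exp (-θ * Complex.I) := by
      rw [← Complex.exp_add]; congr 1; push_cast; ring
    rw [e1, e2]
    push_cast
    rw [Complex.sin]
    field_simp
    rw [Complex.I_sq]
    ring
  · apply Continuous.intervalIntegrable; fun_prop
  · apply Continuous.intervalIntegrable; fun_prop

noncomputable def gJ (k : ℕ) : ℝ := ∫ r in Set.Ioi (0:ℝ), r^(2*k+1) * Real.exp (-π * r^2)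

theorem gJ_integrable (k : ℕ) :
    Integrable (fun r : ℝ => r^(2*k+1) * Real.exp (-π * r^2)) (volume.restrict (Set.Ioi 0)) := by
  have := integrableOn_rpow_mul_exp_neg_mul_sq pi_pos (s := ((2*k+1 : ℕ) : ℝ))
    (lt_of_lt_of_le (by norm_num) (Nat.cast_nonneg _))
  simp only [Real.rpow_natCast] at this
  exact this

theorem gJ_eq (k : ℕ) : gJ k = (k.factorial : ℝ) / (2 * π^(k+1)) := by
  have := integral_rpow_mul_exp_neg_mul_rpow (p := ((2:ℕ):ℝ)) (q := ((2*k+1 : ℕ) : ℝ)) (b := π) (by norm_num)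
    (lt_of_lt_of_le (by norm_num) (Nat.cast_nonneg _)) pi_pos
  simp only [Real.rpow_natCast] at this
  rw [gJ, this]
  have e : (((2*k+1 : ℕ) : ℝ) + 1) / ((2:ℕ):ℝ) = (k:ℝ) + 1 := by push_cast; ring
  rw [neg_div, e, Real.Gamma_nat_eq_factorial, Real.rpow_neg pi_pos.le,
    show (k:ℝ)+1 = ((k+1 : ℕ) : ℝ) by push_cast; ring, Real.rpow_natCast]
  push_cast
  field_simp

theorem gJ_succ (k : ℕ) : gJ (k+1) = (k+1)/π * gJ k := by
  rw [gJ_eq, gJ_eq, Nat.factorial_succ]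
  have := pi_pos
  push_cast
  field_simp
  ring

theorem gJ_nonneg (k : ℕ) : 0 ≤ gJ k := by
  rw [gJ_eq]; have := pi_pos; positivity

theorem lint_single (B : ℂ) (m : ℕ) :
    ∫⁻ r in Set.Ioi (0:ℝ), ENNReal.ofReal (r * Real.exp (-π * r^2) * ‖B * (r:ℂ)^m‖^2) =
      ENNReal.ofReal (‖B‖^2 * gJ m) := by
  have hi := (gJ_integrable m).const_mul (‖B‖^2)
  rw [gJ, ← integral_const_mul, ofReal_integral_eq_lintegral_ofReal hi]
  · refine lintegral_congr fun r => ?_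
    congr 1
    rw [norm_mul, norm_pow, mul_pow, ← pow_mul, mul_comm m, pow_mul ‖(r:ℂ)‖, Complex.norm_real, Real.norm_eq_abs, sq_abs]
    ring
  · refine (ae_restrict_iff' measurableSet_Ioi).2 (ae_of_all _ fun r hr => ?_)
    have : (0:ℝ) < r := hr
    simp only [Pi.zero_apply]
    positivity

theorem lint_double (A B : ℂ) (k : ℕ) :
    ∫⁻ r in Set.Ioi (0:ℝ), ENNReal.ofReal (r * Real.exp (-π * r^2) *
        ‖(r:ℂ) / (2 * Complex.I) * (A * (r:ℂ)^k - B * (r:ℂ)^(k+2))‖^2) =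
      ENNReal.ofReal (1/4 * (‖A‖^2 * gJ (k+1) - 2 * (A * star B).re * gJ (k+2) + ‖B‖^2 * gJ (k+3))) := by
  have h1 := (gJ_integrable (k+1)).const_mul (‖A‖^2)
  have h2 := (gJ_integrable (k+2)).const_mul (2 * (A * star B).re)
  have h3 := (gJ_integrable (k+3)).const_mul (‖B‖^2)
  have hi := ((h1.sub h2).add h3).const_mul (1/4)
  have hp : ∀ r : ℝ, r * Real.exp (-π * r^2) *
        ‖(r:ℂ) / (2 * Complex.I) * (A * (r:ℂ)^k - B * (r:ℂ)^(k+2))‖^2 = 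
      1/4 * ((‖A‖^2 * (r^(2*(k+1)+1) * Real.exp (-π * r^2)) - 2 * (A * star B).re * (r^(2*(k+2)+1) * Real.exp (-π * r^2)))
        + ‖B‖^2 * (r^(2*(k+3)+1) * Real.exp (-π * r^2))) := by
    intro r
    have e : ‖(r:ℂ) / (2 * Complex.I) * (A * (r:ℂ)^k - B * (r:ℂ)^(k+2))‖^2 =
        r^2 / 4 * (r^(2*k)) * ‖A - B * ((r^2 : ℝ):ℂ)‖^2 := by
      rw [show A * (r:ℂ)^k - B * (r:ℂ)^(k+2) = (r:ℂ)^k * (A - B * ((r^2 : ℝ):ℂ)) by push_cast; ring]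
      rw [norm_mul, norm_mul, norm_div, norm_pow, norm_mul, mul_pow, mul_pow, div_pow, Complex.norm_real,
        Real.norm_eq_abs, sq_abs, ← pow_mul, mul_comm k, pow_mul |r|, sq_abs]
      simp
      ring
    have e3 : ‖A - B * ((r^2 : ℝ):ℂ)‖^2 = ‖A‖^2 - 2 * (A * star B).re * r^2 + ‖B‖^2 * r^4 := by
      simp only [← Complex.normSq_eq_norm_sq, Complex.normSq_apply]
      simp only [Complex.sub_re, Complex.sub_im, Complex.mul_re, Complex.mul_im, Complex.ofReal_re, Complex.ofReal_im,
        Complex.star_def, Complex.conj_re, Complex.conj_im]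
      ring
    rw [e, e3]
    ring
  have : (1/4 * (‖A‖^2 * gJ (k+1) - 2 * (A * star B).re * gJ (k+2) + ‖B‖^2 * gJ (k+3)))
     = ∫ r in Set.Ioi (0:ℝ), r * Real.exp (-π * r^2) *
        ‖(r:ℂ) / (2 * Complex.I) * (A * (r:ℂ)^k - B * (r:ℂ)^(k+2))‖^2 := by
    simp_rw [hp]
    have h4 := integral_add (h1.sub h2) h3
    have h5 := integral_sub h1 h2
    simp only [Pi.sub_apply] at h4
    rw [integral_const_mul, h4, h5]
    simp only [integral_const_mul]
    rfl
  rw [this, ofReal_integral_eq_lintegral_ofReal]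
  · simp_rw [hp]; exact hi
  · refine (ae_restrict_iff' measurableSet_Ioi).2 (ae_of_all _ fun r hr => ?_)
    have : (0:ℝ) < r := hr
    simp only [Pi.zero_apply]
    positivity

theorem term_ineq (a : ℕ → ℂ) (m : ℕ) :
    ENNReal.ofReal (1/(4*π)) * ∫⁻ r in Set.Ioi (0:ℝ),
        ENNReal.ofReal (r * Real.exp (-π * r^2) * ‖circC a r m‖^2) ≤
    ∫⁻ r in Set.Ioi (0:ℝ), ENNReal.ofReal (r * Real.exp (-π * r^2) *
      ‖(r:ℂ) / (2 * Complex.I) * (circC a r ((m:ℤ)-1-1) - circC a r ((m:ℤ)-1+1))‖^2) := by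
  have hpi := pi_pos
  have hm : ∀ r, circC a r m = a m * (r:ℂ)^m := fun r => by simp [circC]
  rw [sub_add_cancel]
  simp_rw [hm]
  rw [lint_single, ← ENNReal.ofReal_mul (by positivity)]
  obtain hlt | ⟨k, rfl⟩ : m < 2 ∨ ∃ k, m = k + 2 := by
    rcases lt_or_ge m 2 with h | h
    · exact Or.inl h
    · exact Or.inr ⟨m-2, by omega⟩
  · have hz : ∀ r, circC a r ((m:ℤ)-1-1) = 0 := fun r => by
      rw [circC, if_neg]; omega
    simp_rw [hz]
    have : ∀ r : ℝ, ‖(r:ℂ) / (2 * Complex.I) * (0 - a m * (r:ℂ)^m)‖ = ‖a m / 2 * (r:ℂ)^(m+1)‖ := by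
      intro r
      simp [pow_succ]; ring
    simp_rw [this]
    rw [lint_single, gJ_succ]
    apply ENNReal.ofReal_le_ofReal
    have := gJ_nonneg m
    rw [norm_div, div_pow]
    have h2 : ‖(2:ℂ)‖^2 = 4 := by norm_num
    rw [h2, show ‖a m‖ ^ 2 / 4 * (((m:ℝ) + 1) / π * gJ m) = 1 / (4 * π) * (‖a m‖ ^ 2 * gJ m) * (m+1) by field_simp]
    exact le_mul_of_one_le_right (by positivity) (by linarith [(Nat.cast_nonneg m : (0:ℝ) ≤ m)])
  · have hz : ∀ r, circC a r (((k+2:ℕ):ℤ)-1-1) = a k * (r:ℂ)^k := fun r => by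
      rw [show (((k+2:ℕ):ℤ)-1-1) = (k:ℤ) by push_cast; ring]
      simp [circC]
    simp_rw [hz]
    rw [lint_double]
    apply ENNReal.ofReal_le_ofReal
    rw [gJ_succ (k+2), gJ_succ (k+1)]
    have hJ := gJ_nonneg (k+1)
    set A := a k
    set B := a (k+2)
    have e3 : ‖A - B * ((((k:ℝ)+2)/π : ℝ):ℂ)‖^2 = ‖A‖^2 - 2 * (A * star B).re * (((k:ℝ)+2)/π) + ‖B‖^2 * (((k:ℝ)+2)/π)^2 := by
      simp only [← Complex.normSq_eq_norm_sq, Complex.normSq_apply]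
      simp only [Complex.sub_re, Complex.sub_im, Complex.mul_re, Complex.mul_im, Complex.ofReal_re, Complex.ofReal_im,
        Complex.star_def, Complex.conj_re, Complex.conj_im]
      ring
    have h0 : 0 ≤ 1/4 * (gJ (k+1) * ‖A - B * ((((k:ℝ)+2)/π : ℝ):ℂ)‖^2) := by positivity
    rw [e3] at h0
    rw [← sub_nonneg]
    convert h0 using 1
    push_cast
    field_simp
    ring

theorem circC_continuous (a : ℕ → ℂ) (n : ℤ) : Continuous fun r => circC a r n := by
  unfold circC
  split_ifs <;> fun_prop

theorem polar_pars (h : ℝ → ℝ → ℂ) (hh : Continuous fun p : ℝ × ℝ => h p.1 p.2)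
    (v : ℝ × ℝ → ENNReal)
    (hv : ∀ r θ : ℝ, v (r * Real.cos θ, r * Real.sin θ) =
      ENNReal.ofReal (Real.exp (-π * r^2) * ‖h r θ‖^2))
    (c : ℝ → ℤ → ℂ) (hc : ∀ n, Continuous fun r => c r n)
    (hcoef : ∀ (r : ℝ) (n : ℤ), ((2*π : ℝ) : ℂ)⁻¹ * ∫ θ in (-π)..π,
      Complex.exp (-(n * θ * Complex.I)) * h r θ = c r n) :
    ∫⁻ p, v p = ENNReal.ofReal (2*π) * ∑' n : ℤ, ∫⁻ r in Set.Ioi (0:ℝ),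
      ENNReal.ofReal (r * Real.exp (-π * r^2) * ‖c r n‖^2) := by
  have hcm : ∀ n : ℤ, Measurable fun r =>
      ENNReal.ofReal (r * Real.exp (-π * r^2) * ‖c r n‖^2) := fun n => by
    have := (hc n).measurable
    fun_prop
  rw [← lintegral_comp_polarCoord_symm, polarCoord_target, Measure.volume_eq_prod,
    ← Measure.prod_restrict]
  have e : ∀ p : ℝ × ℝ, ENNReal.ofReal p.1 • v (polarCoord.symm p) =
      ENNReal.ofReal p.1 * ENNReal.ofReal (Real.exp (-π * p.1^2) * ‖h p.1 p.2‖^2) := fun p => by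
    rw [polarCoord_symm_apply, hv, smul_eq_mul]
  simp_rw [e]
  rw [lintegral_prod _ (by have := hh.measurable; apply Measurable.aemeasurable; fun_prop)]
  rw [← lintegral_tsum (fun n => (hcm n).aemeasurable), ← lintegral_const_mul _ (by fun_prop)]
  refine setLIntegral_congr_fun measurableSet_Ioi fun r hr => ?_
  have hr0 : (0:ℝ) < r := hr
  simp only
  have hcr : Continuous (h r) := hh.comp (by fun_prop : Continuous fun θ : ℝ => (r, θ))
  simp_rw [ENNReal.ofReal_mul (Real.exp_nonneg (-π * r^2)), ← mul_assoc]
  rw [lintegral_const_mul _ (by have := hcr.measurable; fun_prop), parseval_aux _ hcr]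
  simp_rw [hcoef]
  rw [← mul_assoc, mul_comm _ (ENNReal.ofReal (2*π)), mul_assoc, ← ENNReal.tsum_mul_left]
  congr 1
  refine tsum_congr fun n => ?_
  rw [← ENNReal.ofReal_mul hr0.le, ← ENNReal.ofReal_mul (by positivity)]

theorem second_moment (u : ℝ × ℝ → ℂ)
    (f : ℂ → ℂ) (hf : Differentiable ℂ f)
    (huf : ∀ x₁ x₂ : ℝ,
      u (x₁, x₂) = f (x₁ + x₂ * Complex.I)
        * Complex.exp (-(π:ℂ)/2 * ((x₁^2 + x₂^2 : ℝ) : ℂ))) :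
    ENNReal.ofReal (1/(4*π)) * ∫⁻ p : ℝ × ℝ, ENNReal.ofReal (‖u p‖^2) ≤
      ∫⁻ p : ℝ × ℝ, ENNReal.ofReal (p.2^2 * ‖u p‖^2) := by
  obtain ⟨a, hs⟩ : ∃ a : ℕ → ℂ, ∀ z, HasSum (fun k => a k * z^k) (f z) := by
    refine ⟨fun k => ((k.factorial : ℂ))⁻¹ * iteratedDeriv k f 0, fun z => ?_⟩
    have := Complex.hasSum_taylorSeries_of_entire hf 0 z
    have e : (fun k : ℕ => ((k.factorial : ℂ))⁻¹ * iteratedDeriv k f 0 * z^k) =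
        fun n : ℕ => ((n.factorial : ℂ))⁻¹ • (z - 0) ^ n • iteratedDeriv n f 0 := by
      funext k
      rw [sub_zero, smul_eq_mul, smul_eq_mul]
      ring
    simp only [e]
    exact this
  have hfc := hf.continuous
  have hu : ∀ r θ : ℝ, ‖u (r * Real.cos θ, r * Real.sin θ)‖^2 =
      Real.exp (-π * r^2) * ‖f (r * Complex.exp (θ * Complex.I))‖^2 := by
    intro r θ
    rw [huf, norm_mul, mul_pow, Complex.norm_exp, mul_comm]
    congr 1
    · rw [← Real.exp_nat_mul]
      congr 1
      have : (r * Real.cos θ)^2 + (r * Real.sin θ)^2 = r^2 := by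
        have := Real.sin_sq_add_cos_sq θ
        linear_combination r^2 * this
      rw [this, Complex.re_mul_ofReal]
      simp
      ring
    · congr 3
      rw [Complex.exp_mul_I]
      push_cast
      ring
  rw [polar_pars (fun r θ => f (r * Complex.exp (θ * Complex.I))) (by fun_prop)
      (fun p => ENNReal.ofReal (‖u p‖^2)) (fun r θ => by rw [hu]) (circC a) (circC_continuous a)
      (coef_aux f a hs),
    polar_pars (fun r θ => ((r * Real.sin θ : ℝ) : ℂ) * f (r * Complex.exp (θ * Complex.I)))
      (by fun_prop)
      (fun p => ENNReal.ofReal (p.2^2 * ‖u p‖^2))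
      (fun r θ => by
        simp only
        rw [hu, norm_mul, mul_pow ‖_‖, Complex.norm_real, Real.norm_eq_abs, sq_abs]
        congr 1; ring)
      (fun r n => r / (2 * Complex.I) * (circC a r (n-1) - circC a r (n+1)))
      (fun n => by
        have h1 := circC_continuous a (n-1)
        have h2 := circC_continuous a (n+1)
        fun_prop)
      (coef_aux2 f a hs hfc)]
  rw [mul_left_comm]
  gcongr
  have hsupp : ∑' n : ℤ, ∫⁻ r in Set.Ioi (0:ℝ),
      ENNReal.ofReal (r * Real.exp (-π * r^2) * ‖circC a r n‖^2) =
      ∑' m : ℕ, ∫⁻ r in Set.Ioi (0:ℝ),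
      ENNReal.ofReal (r * Real.exp (-π * r^2) * ‖circC a r (m:ℤ)‖^2) := by
    symm
    refine Function.Injective.tsum_eq (g := ((↑) : ℕ → ℤ)) Nat.cast_injective
      (f := fun n : ℤ => ∫⁻ r in Set.Ioi (0:ℝ),
        ENNReal.ofReal (r * Real.exp (-π * r^2) * ‖circC a r n‖^2)) ?_
    intro n hn
    by_contra hneg
    apply hn
    have : ¬ 0 ≤ n := fun h => hneg ⟨n.toNat, by simp [h]⟩
    simp [circC, this]
  rw [hsupp, ← ENNReal.tsum_mul_left]
  refine (ENNReal.tsum_le_tsum fun m => term_ineq a m).trans ?_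
  exact ENNReal.tsum_comp_le_tsum_of_injective (f := fun m : ℕ => (m:ℤ) - 1)
    (fun x y h => by simpa using h)
    (fun n : ℤ => ∫⁻ r in Set.Ioi (0:ℝ), ENNReal.ofReal (r * Real.exp (-π * r^2) *
      ‖(r:ℂ) / (2 * Complex.I) * (circC a r (n-1) - circC a r (n+1))‖^2))

/-- Lower bound `E(u) ≥ κ²/(8π)` for the Gross–Pitaevskii energy of a
normalized `u` in the lowest Landau level `Λ₀`. -/
theorem energy_lower_bound (ε κ g₀ : ℝ) (hε : 0 < ε) (hκ : 0 < κ)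
    (hg : 0 < g₀)
    (u : ℝ × ℝ → ℂ)
    (f : ℂ → ℂ) (hf : Differentiable ℂ f)
    (huf : ∀ x₁ x₂ : ℝ,
      u (x₁, x₂) = f (x₁ + x₂ * Complex.I)
        * Complex.exp (-(π:ℂ)/2 * ((x₁^2 + x₂^2 : ℝ) : ℂ)))
    (hnorm : ∫⁻ p : ℝ × ℝ, ENNReal.ofReal (‖u p‖^2) = 1) :
    (∫⁻ p : ℝ × ℝ,
        ENNReal.ofReal ((1/2) * (ε^2 * (p.1)^2 + κ^2 * (p.2)^2) * ‖u p‖^2))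
      + ∫⁻ p : ℝ × ℝ, ENNReal.ofReal ((g₀/2) * ‖u p‖^4)
      ≥ ENNReal.ofReal (κ^2/(8*π)) := by
  have key := second_moment u f hf huf
  rw [hnorm, mul_one] at key
  refine le_trans ?_ le_self_add
  calc ENNReal.ofReal (κ^2/(8*π)) = ENNReal.ofReal (κ^2/2) * ENNReal.ofReal (1/(4*π)) := by
        rw [← ENNReal.ofReal_mul (by positivity)]
        congr 1
        have := pi_pos
        field_simp
        norm_num
    _ ≤ ENNReal.ofReal (κ^2/2) * ∫⁻ p : ℝ × ℝ, ENNReal.ofReal (p.2^2 * ‖u p‖^2) := by gcongr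
    _ = ∫⁻ p : ℝ × ℝ, ENNReal.ofReal (κ^2/2) * ENNReal.ofReal (p.2^2 * ‖u p‖^2) := by
        rw [lintegral_const_mul' _ _ ENNReal.ofReal_ne_top]
    _ ≤ _ := by
        refine lintegral_mono fun p => ?_
        rw [← ENNReal.ofReal_mul (by positivity)]
        apply ENNReal.ofReal_le_ofReal
        have : 0 ≤ ε^2 * p.1^2 * ‖u p‖^2 := by positivity
        nlinarith
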